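/- There exists a constant c > 0 such that the following holds. Let X_1, ..., X_t be independent uniform {0,1}-valued random variables and X = (sum_i X_i)/t. Then for every 0 <= epsilon <= 1/2, Pr[|X - 1/2| >= epsilon] >= 2^{-ceil(c * t * epsilon^2)}. -/

import Mathlib

open Finset in
theorem cc_count (t : ℕ) (P : ℕ → Prop) [DecidablePred P] :
    (univ.filter fun b : Fin t → Bool => P (univ.filter fun i => b i = true).card).card
      = ∑ k ∈ (range (t+1)).filter P, t.choose k := by
  rw [card_eq_sum_card_fiberwise (f := fun b : Fin t → Bool => (univ.filter fun i => b i = true).card)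
    (t := (range (t+1)).filter P)]
  · apply sum_congr rfl
    intro k hk
    simp only [mem_filter, mem_range] at hk
    have h1 : (powersetCard k (univ : Finset (Fin t))).card = t.choose k := by simp
    rw [← h1]
    apply card_nbij' (fun b => univ.filter fun i => b i = true) (fun s i => decide (i ∈ s))
    · intro b hb
      simp at hb
      simp [hb.2]
    · intro s hs
      simp at hs
      simp [hs, hk.2]
    · intro b hb
      simp
    · intro s hs
      simp
  · intro b hb
    simp at hb ⊢
    refine ⟨?_, hb⟩
    have := card_le_univ (univ.filter fun i => b i = true)
    simp at this
    omega

theorem cc_central_upper (n : ℕ) : (2*n+1) * n.centralBinom^2 ≤ 4^(2*n) := by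
  induction n with
  | zero => simp
  | succ n ih =>
    have h := Nat.succ_mul_centralBinom_succ n
    have e : (4:ℕ)^(2*(n+1)) = 16 * 4^(2*n) := by ring
    rw [e]
    have h2 : (n+1)^2 * ((2*(n+1)+1) * (n+1).centralBinom^2)
        = (2*n+3) * (2*n+1) * 4 * ((2*n+1) * n.centralBinom^2) := by
      calc _ = (2*n+3) * ((n+1) * (n+1).centralBinom)^2 := by ring
        _ = _ := by rw [h]; ring
    have h3 : (n+1)^2 * ((2*(n+1)+1) * (n+1).centralBinom^2) ≤ (n+1)^2 * (16 * 4^(2*n)) := by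
      rw [h2]
      calc _ ≤ (2*n+3) * (2*n+1) * 4 * 4^(2*n) := Nat.mul_le_mul_left _ ih
        _ ≤ ((n+1)^2 * 16) * 4^(2*n) := Nat.mul_le_mul_right _ (by nlinarith)
        _ = _ := by ring
    exact Nat.le_of_mul_le_mul_left h3 (by positivity)

theorem cc_central_lower (n : ℕ) : 4^(2*(n+1)) ≤ 4*(n+1) * (n+1).centralBinom^2 := by
  induction n with
  | zero => simp [Nat.centralBinom, Nat.choose]
  | succ n ih =>
    have h := Nat.succ_mul_centralBinom_succ (n+1)
    have e : (4:ℕ)^(2*(n+1+1)) = 16 * 4^(2*(n+1)) := by ring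
    rw [e]
    have h2 : (n+1+1) * (n+1) * (4*(n+1+1) * (n+1+1).centralBinom^2)
        = 4 * (2*(n+1)+1)^2 * (4*(n+1) * (n+1).centralBinom^2) := by
      calc _ = 4 * (n+1) * ((n+1+1) * (n+1+1).centralBinom)^2 := by ring
        _ = _ := by rw [h]; ring
    have h3 : (n+1+1) * (n+1) * (16 * 4^(2*(n+1))) ≤
        (n+1+1) * (n+1) * (4*(n+1+1) * (n+1+1).centralBinom^2) := by
      rw [h2]
      calc _ = ((n+1+1) * (n+1) * 16) * 4^(2*(n+1)) := by ring
        _ ≤ (4 * (2*(n+1)+1)^2) * 4^(2*(n+1)) := Nat.mul_le_mul_right _ (by nlinarith)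
        _ ≤ _ := Nat.mul_le_mul_left _ ih
    exact Nat.le_of_mul_le_mul_left h3 (by positivity)

theorem cc_odd (n : ℕ) : (n+1).centralBinom = 2 * (2*n+1).choose n := by
  rw [Nat.centralBinom, show 2*(n+1) = (2*n+1)+1 by ring, Nat.choose_succ_succ]
  have := Nat.choose_symm_half n
  rw [Nat.succ_eq_add_one]
  omega

theorem cc_upper (t : ℕ) : (t+1) * (t.choose (t/2))^2 ≤ 4^t := by
  rcases Nat.even_or_odd' t with ⟨n, rfl | rfl⟩
  · have := cc_central_upper n
    rw [show 2*n/2 = n by omega]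
    exact this
  · have := cc_central_upper (n+1)
    rw [cc_odd] at this
    rw [show (2*n+1)/2 = n by omega]
    rw [show (4:ℕ)^(2*(n+1)) = 4 * 4^(2*n+1) by ring] at this
    nlinarith [sq_nonneg ((2*n+1).choose n)]

theorem cc_lower (t : ℕ) (ht : 1 ≤ t) : 4^t ≤ 2 * (t+1) * (t.choose (t/2))^2 := by
  rcases Nat.even_or_odd' t with ⟨n, rfl | rfl⟩
  · obtain ⟨n, rfl⟩ : ∃ m, n = m+1 := ⟨n-1, by omega⟩
    have := cc_central_lower n
    rw [show 2*(n+1)/2 = n+1 by omega]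
    rw [Nat.centralBinom] at this
    nlinarith [sq_nonneg ((2*(n+1)).choose (n+1))]
  · have := cc_central_lower n
    rw [cc_odd] at this
    rw [show (2*n+1)/2 = n by omega]
    rw [show (4:ℕ)^(2*(n+1)) = 4 * 4^(2*n+1) by ring] at this
    nlinarith [sq_nonneg ((2*n+1).choose n)]

theorem cc_half (t : ℕ) (ht : 1 ≤ t) : 2 * t.choose (t/2) ≤ 2^t := by
  rcases Nat.lt_or_ge t 3 with h | h
  · interval_cases t <;> simp [Nat.choose]
  · have := cc_upper t
    have h4 : (4:ℕ)^t = (2^t)^2 := by rw [← pow_mul, mul_comm, pow_mul]; norm_num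
    rw [h4] at this
    apply (Nat.pow_le_pow_iff_left (n := 2) (by norm_num)).1
    nlinarith [sq_nonneg (t.choose (t/2))]

theorem cc_base (t : ℕ) (ht : 1 ≤ t) (x : ℝ) (hx0 : 0 ≤ x) (hx : 144 * x^2 ≤ t) (s : Finset ℕ)
    (hs : ∀ k ∈ s, |(k:ℝ) - t/2| < x) : 2 * (∑ k ∈ s, (t.choose k : ℝ)) ≤ 2^t := by
  rcases s.eq_empty_or_nonempty with rfl | hne
  · simp
  have hsub : s ⊆ Finset.Icc (s.min' hne) (s.min' hne + ⌊2*x⌋₊) := by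
    intro k hk
    have h1 := s.min'_le k hk
    have h2 := abs_lt.1 (hs k hk)
    have h3 := abs_lt.1 (hs _ (s.min'_mem hne))
    rw [Finset.mem_Icc]
    refine ⟨h1, ?_⟩
    have : k - s.min' hne ≤ ⌊2*x⌋₊ := by
      apply Nat.le_floor
      rw [Nat.cast_sub h1]
      linarith [h2.2, h3.1]
    omega
  have hcard : s.card ≤ ⌊2*x⌋₊ + 1 := by
    have := Finset.card_le_card hsub
    rw [Nat.card_Icc] at this
    omega
  have hsum : (∑ k ∈ s, (t.choose k : ℝ)) ≤ s.card * (t.choose (t/2) : ℝ) := by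
    rw [← nsmul_eq_mul]
    apply Finset.sum_le_card_nsmul
    intro k _
    exact_mod_cast Nat.choose_le_middle k t
  have hM0 : (0:ℝ) ≤ t.choose (t/2) := by positivity
  rcases Nat.lt_or_ge t 36 with h | h
  · have ht' : (t:ℝ) < 36 := by exact_mod_cast h
    have : ⌊2*x⌋₊ = 0 := by
      rw [Nat.floor_eq_zero]
      nlinarith
    have hc : (s.card:ℝ) ≤ 1 := by exact_mod_cast (by omega : s.card ≤ 1)
    have hm : (2:ℝ) * t.choose (t/2) ≤ 2^t := by exact_mod_cast cc_half t ht
    nlinarith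
  · have ht' : (36:ℝ) ≤ t := by exact_mod_cast h
    have hc : (s.card:ℝ) ≤ 2*x+1 := by
      have h1 : (s.card:ℝ) ≤ ⌊2*x⌋₊ + 1 := by exact_mod_cast hcard
      have := Nat.floor_le (show 0 ≤ 2*x by linarith)
      linarith
    have hu : ((t:ℝ)+1) * (t.choose (t/2) : ℝ)^2 ≤ 4^t := by exact_mod_cast cc_upper t
    have h4 : (4:ℝ)^t = (2^t)^2 := by rw [← pow_mul, mul_comm, pow_mul]; norm_num
    have key : 2 * ((2*x+1) * (t.choose (t/2) : ℝ)) ≤ 2^t := by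
      refine (pow_le_pow_iff_left₀ (n := 2) (by positivity) (by positivity) (by norm_num)).1 ?_
      rw [← h4]
      have : 4*(2*x+1)^2 ≤ (t:ℝ) + 1 := by nlinarith [sq_nonneg (2*x-1)]
      calc _ = (4*(2*x+1)^2) * (t.choose (t/2) : ℝ)^2 := by ring
        _ ≤ _ := mul_le_mul_of_nonneg_right this (by positivity)
        _ ≤ _ := hu
    nlinarith [mul_le_mul_of_nonneg_right hc hM0]

theorem cc_ratio (t j : ℕ) (hj : 2*j ≤ t/2) :
    (t.choose (t/2) : ℝ) ≤ t.choose (t/2 - j) * Real.exp (2*j*(j+1)/((t/2 : ℕ):ℝ)) := by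
  induction j with
  | zero => simp
  | succ i ih =>
    have ih := ih (by omega)
    set h := t/2 with hh
    have hpos : (0:ℝ) < h := by exact_mod_cast (by omega : 0 < h)
    obtain ⟨m, hm⟩ : ∃ m, h - i = m + 1 := ⟨h-i-1, by omega⟩
    have hm' : h - (i+1) = m := by omega
    have e := Nat.choose_succ_right_eq t m
    rw [hm] at ih
    rw [hm']
    have eR : (t.choose (m+1) : ℝ) * (m+1) = t.choose m * ((t - m : ℕ):ℝ) := by exact_mod_cast e
    have htm : ((t-m:ℕ):ℝ) ≤ m + 2*i+3 := by
      exact_mod_cast (by omega : t - m ≤ m + 2*i+3)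
    have hmh : (h:ℝ) ≤ 2*(m+1) := by exact_mod_cast (by omega : h ≤ 2*(m+1))
    have hq : ((m:ℝ)+2*i+3) ≤ (m+1) * Real.exp ((4*i+4)/h) := by
      have h1 := Real.add_one_le_exp (((4:ℝ)*i+4)/h)
      have h2 : (2*(i:ℝ)+2) ≤ (m+1) * ((4*i+4)/h) := by
        rw [← mul_div_assoc, le_div_iff₀ hpos]
        nlinarith [(Nat.cast_nonneg i : (0:ℝ) ≤ i)]
      have : (0:ℝ) ≤ m+1 := by positivity
      nlinarith
    have hstep : (t.choose (m+1) : ℝ) ≤ t.choose m * Real.exp ((4*i+4)/h) := by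
      have hm1 : (0:ℝ) < m+1 := by positivity
      apply le_of_mul_le_mul_right _ hm1
      rw [eR]
      calc _ ≤ (t.choose m:ℝ) * ((m+1) * Real.exp ((4*i+4)/h)) :=
            mul_le_mul_of_nonneg_left (htm.trans hq) (by positivity)
        _ = _ := by ring
    calc _ ≤ _ := ih
      _ ≤ (t.choose m * Real.exp ((4*i+4)/h)) * Real.exp (2*i*(i+1)/h) :=
          mul_le_mul_of_nonneg_right hstep (Real.exp_pos _).le
      _ = _ := by
        rw [mul_assoc, ← Real.exp_add]
        congr 2
        push_cast
        field_simp
        ring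

theorem cc_far (t : ℕ) (ht : 2 ≤ t) (x : ℝ) (hx0 : 0 < x) (hx : (t:ℝ) < 144 * x^2)
    (hx2 : 50 * x ≤ ((t/2:ℕ):ℝ)) (s : Finset ℕ)
    (hs : ∀ k ≤ t, x ≤ |(k:ℝ) - t/2| → k ∈ s) :
    2^t * Real.exp (-(7644 * (x^2/t))) ≤ ∑ k ∈ s, (t.choose k : ℝ) := by
  set h := t/2 with hh
  set r := √(t:ℝ) with hr
  have htR : (2:ℝ) ≤ t := by exact_mod_cast ht
  have hr2 : r^2 = t := Real.sq_sqrt (by positivity)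
  have hr0 : 0 ≤ r := Real.sqrt_nonneg _
  have hr1 : 1 ≤ r := by nlinarith
  have hrx : r ≤ 12 * x := by nlinarith
  set a := ⌈x⌉₊ with ha
  set L := ⌈r⌉₊ with hL
  have ha1 : x ≤ a := Nat.le_ceil x
  have ha2 : (a:ℝ) < x + 1 := Nat.ceil_lt_add_one hx0.le
  have hL1 : r ≤ L := Nat.le_ceil r
  have hL2 : (L:ℝ) < r + 1 := Nat.ceil_lt_add_one hr0
  have hpos : (0:ℝ) < h := by exact_mod_cast (by omega : 0 < h)
  have h3 : (t:ℝ) ≤ 3 * h := by exact_mod_cast (by omega : t ≤ 3*h)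
  have hth : 2 * (h:ℝ) ≤ t := by exact_mod_cast (by omega : 2*h ≤ t)
  set E := Real.exp (-(7500 * (x^2/t))) with hE
  set M : ℝ := ((t.choose h : ℕ) : ℝ) with hM
  have hj : ∀ i < L, (h - (a + i) ∈ s ∧ 2*(a+i) ≤ h) ∧ M * E ≤ (t.choose (h - (a+i)) : ℝ) := by
    intro i hi
    have hiL : (i:ℝ) + 1 ≤ L := by exact_mod_cast hi
    have hle : ((a + i : ℕ):ℝ) ≤ 25 * x := by push_cast; linarith
    have h2 : 2*(a+i) ≤ h := by
      have : (2:ℝ) * ((a+i:ℕ):ℝ) ≤ h := by linarith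
      exact_mod_cast this
    have hge : x ≤ ((a+i:ℕ):ℝ) := by push_cast; linarith [(Nat.cast_nonneg i : (0:ℝ) ≤ i)]
    have hge1 : (1:ℝ) ≤ ((a+i:ℕ):ℝ) := by
      have : 1 ≤ a := Nat.one_le_ceil_iff.2 hx0
      exact_mod_cast (by omega : 1 ≤ a + i)
    have hrat := cc_ratio t (a+i) h2
    rw [← hh] at hrat
    set j := a + i with hjdef
    refine ⟨⟨?_, h2⟩, ?_⟩
    · apply hs
      · omega
      · rw [Nat.cast_sub (by omega), abs_sub_comm]
        apply le_trans _ (le_abs_self _)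
        linarith
    · have hexp : 2*(j:ℝ)*(j+1)/h ≤ 7500 * (x^2/t) := by
        have h1 : 2*(j:ℝ)*(j+1) ≤ 2500*x^2 := by nlinarith
        rw [← mul_div_assoc, div_le_div_iff₀ hpos (by linarith)]
        calc 2*(j:ℝ)*(j+1) * t ≤ 2500*x^2 * (3*h) := by
              apply mul_le_mul h1 h3 (by positivity) (by positivity)
          _ = _ := by ring
      calc M * E ≤ (t.choose (h-j) * Real.exp (2*j*(j+1)/(h:ℝ))) * E :=
            mul_le_mul_of_nonneg_right hrat (Real.exp_pos _).le
        _ = t.choose (h-j) * Real.exp (2*j*(j+1)/(h:ℝ) - 7500 * (x^2/t)) := by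
            rw [hE, mul_assoc, ← Real.exp_add, sub_eq_add_neg]
        _ ≤ t.choose (h-j) * 1 := by
            apply mul_le_mul_of_nonneg_left _ (by positivity)
            apply Real.exp_le_one_iff.2
            linarith
        _ = _ := by ring
  have hinj : Set.InjOn (fun i => h - (a+i)) (Finset.range L : Set ℕ) := by
    intro i hi i' hi' e
    simp only [Finset.coe_range, Set.mem_Iio] at hi hi' e
    have := (hj i hi).1.2
    have := (hj i' hi').1.2
    omega
  have hsum : (L:ℝ) * (M * E) ≤ ∑ k ∈ s, (t.choose k : ℝ) := by
    calc (L:ℝ) * (M * E) = ∑ i ∈ Finset.range L, M * E := by simp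
      _ ≤ ∑ i ∈ Finset.range L, (t.choose (h - (a+i)) : ℝ) :=
          Finset.sum_le_sum fun i hi => (hj i (Finset.mem_range.1 hi)).2
      _ = ∑ k ∈ (Finset.range L).image (fun i => h - (a+i)), (t.choose k : ℝ) := by
          rw [Finset.sum_image hinj]
      _ ≤ _ := by
          apply Finset.sum_le_sum_of_subset_of_nonneg
          · intro k hk
            obtain ⟨i, hi, rfl⟩ := Finset.mem_image.1 hk
            exact (hj i (Finset.mem_range.1 hi)).1.1
          · intros; positivity
  have hE0 : 0 < E := Real.exp_pos _
  have hM0 : 0 ≤ M := by positivity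
  have hlow : (4:ℝ)^t ≤ 2 * (t+1) * M^2 := by
    rw [hM, hh]
    exact_mod_cast cc_lower t (by omega)
  have h4 : (4:ℝ)^t = (2^t)^2 := by rw [← pow_mul, mul_comm, pow_mul]; norm_num
  have hMr : (2:ℝ)^t ≤ 2 * (r * M) := by
    refine (pow_le_pow_iff_left₀ (n := 2) (by positivity) (by positivity) (by norm_num)).1 ?_
    rw [← h4]
    calc _ ≤ _ := hlow
      _ ≤ 4 * t * M^2 := mul_le_mul_of_nonneg_right (by linarith) (by positivity)
      _ = _ := by rw [← hr2]; ring
  have hsplit : Real.exp (-(7644 * (x^2/t))) ≤ 1/2 * E := by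
    have h1 : 1 ≤ 144 * (x^2/t) := by
      rw [← mul_div_assoc, le_div_iff₀ (by linarith)]; linarith
    have h2 : Real.exp (-(144 * (x^2/t))) ≤ 1/2 := by
      rw [Real.exp_neg, one_div]
      apply inv_anti₀ (by norm_num)
      linarith [Real.add_one_le_exp (144 * (x^2/t))]
    calc _ = Real.exp (-(144 * (x^2/t))) * E := by rw [hE, ← Real.exp_add]; congr 1; ring
      _ ≤ _ := mul_le_mul_of_nonneg_right h2 hE0.le
  calc _ ≤ 2^t * (1/2 * E) := mul_le_mul_of_nonneg_left hsplit (by positivity)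
    _ = (2^t) * (E / 2) := by ring
    _ ≤ (2 * (r * M)) * (E/2) := mul_le_mul_of_nonneg_right hMr (by positivity)
    _ = r * (M * E) := by ring
    _ ≤ L * (M * E) := mul_le_mul_of_nonneg_right hL1 (by positivity)
    _ ≤ _ := hsum

/-- Partial converse of the Chernoff bound: there is a constant `c > 0` such that
for `t` independent unbiased coin flips with average `X`, and `0 ≤ ε ≤ 1/2`,
`Pr[|X - 1/2| ≥ ε] ≥ 2^{-⌈c t ε²⌉}`. The probability is computed by counting over
the uniform choice of `b : Fin t → Bool`. -/
theorem chernoff_converse :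
    ∃ c : ℝ, 0 < c ∧ ∀ (t : ℕ) (ε : ℝ), 0 ≤ ε → ε ≤ 1 / 2 →
      (2 : ℝ) ^ (-(⌈c * t * ε ^ 2⌉ : ℤ)) ≤
        ((Finset.univ.filter fun b : Fin t → Bool =>
            ε ≤ |((Finset.univ.filter fun i => b i = true).card : ℝ) / t - 1 / 2|).card : ℝ)
          / 2 ^ t := by
  refine ⟨22500, by norm_num, ?_⟩
  intro t ε h0 h1
  have hcount := cc_count t (fun k => ε ≤ |(k:ℝ)/t - 1/2|)
  rw [hcount]
  push_cast
  rw [le_div_iff₀ (by positivity)]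
  set s := (Finset.range (t+1)).filter (fun k : ℕ => ε ≤ |(k:ℝ)/t - 1/2|) with hs
  have hpow : ∀ y : ℝ, y ≤ 22500 * t * ε^2 →
      (2:ℝ) ^ (-(⌈(22500:ℝ) * t * ε ^ 2⌉ : ℤ)) ≤ Real.exp (-(y * Real.log 2)) := by
    intro y hy
    rw [← Real.rpow_intCast, Real.rpow_def_of_pos (by norm_num)]
    apply Real.exp_le_exp.2
    push_cast
    have := Int.le_ceil ((22500:ℝ) * t * ε ^ 2)
    nlinarith [Real.log_pos (show (1:ℝ) < 2 by norm_num)]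
  have hzero : 0 ∈ s := by
    simp only [hs, Finset.mem_filter, Finset.mem_range]
    refine ⟨by omega, ?_⟩
    rw [Nat.cast_zero, zero_div, zero_sub, abs_neg, abs_of_pos (by norm_num)]
    exact h1
  have hone : (1:ℝ) ≤ ∑ k ∈ s, (t.choose k : ℝ) := by
    have := Finset.single_le_sum (f := fun k => (t.choose k : ℝ)) (fun k _ => by positivity) hzero
    simpa using this
  have hexp2 : Real.exp (-((t:ℝ) * Real.log 2)) * 2^t = 1 := by
    rw [Real.exp_neg, mul_comm (t:ℝ), ← Real.rpow_def_of_pos (by norm_num), Real.rpow_natCast]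
    exact inv_mul_cancel₀ (by positivity)
  have hbig : 1 ≤ 150 * ε → (2:ℝ) ^ (-(⌈(22500:ℝ) * t * ε ^ 2⌉ : ℤ)) * 2^t ≤
      ∑ k ∈ s, (t.choose k : ℝ) := by
    intro hε
    refine le_trans ?_ hone
    rw [← hexp2]
    apply mul_le_mul_of_nonneg_right _ (by positivity)
    apply hpow
    have : 1 ≤ 22500 * ε^2 := by nlinarith
    nlinarith [(Nat.cast_nonneg t : (0:ℝ) ≤ t)]
  rcases Nat.eq_zero_or_pos t with rfl | ht
  · simpa using hone
  have htR : (1:ℝ) ≤ t := by exact_mod_cast ht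
  have hmul : ∀ k : ℕ, (t:ℝ) * |(k:ℝ)/t - 1/2| = |(k:ℝ) - t/2| := by
    intro k
    nth_rewrite 1 [← abs_of_pos (show (0:ℝ) < t by linarith)]
    rw [← abs_mul]
    congr 1
    field_simp
  rcases h0.eq_or_lt with rfl | hpos
  · have : s = Finset.range (t+1) := by
      rw [hs, Finset.filter_true_of_mem]
      intros; positivity
    rw [this]
    have := Nat.sum_range_choose t
    have h : (∑ k ∈ Finset.range (t+1), (t.choose k : ℝ)) = 2^t := by exact_mod_cast this
    rw [h]
    simp
  rcases le_or_gt (144 * (t * ε)^2) (t:ℝ) with hc | hc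
  · have hb := cc_base t ht (t*ε) (by positivity) hc
      ((Finset.range (t+1)).filter (fun k : ℕ => ¬ ε ≤ |(k:ℝ)/t - 1/2|)) (by
        intro k hk
        have := (Finset.mem_filter.1 hk).2
        rw [← hmul]
        exact mul_lt_mul_of_pos_left (not_le.1 this) (by linarith))
    have htot : (∑ k ∈ Finset.range (t+1), (t.choose k : ℝ)) = 2^t := by
      exact_mod_cast Nat.sum_range_choose t
    rw [← Finset.sum_filter_add_sum_filter_not _ (fun k : ℕ => ε ≤ |(k:ℝ)/t - 1/2|)] at htot
    have hp : (2:ℝ) ^ (-(⌈(22500:ℝ) * t * ε ^ 2⌉ : ℤ)) ≤ 1/2 := by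
      have : (1:ℤ) ≤ ⌈(22500:ℝ) * t * ε ^ 2⌉ := Int.one_le_ceil_iff.2 (by positivity)
      calc _ ≤ (2:ℝ)^(-1:ℤ) := zpow_le_zpow_right₀ (by norm_num) (by omega)
        _ = _ := by norm_num
    have := mul_le_mul_of_nonneg_right hp (show (0:ℝ) ≤ 2^t by positivity)
    linarith
  rcases Nat.lt_or_ge t 2 with h2 | h2
  · obtain rfl : t = 1 := by omega
    apply hbig
    push_cast at hc
    nlinarith
  rcases le_or_gt (50 * (t * ε)) (((t/2:ℕ)):ℝ) with hd | hd
  · have hf := cc_far t h2 (t*ε) (by positivity) hc hd s (by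
      intro k hk hx
      rw [← hmul] at hx
      simp only [hs, Finset.mem_filter, Finset.mem_range]
      exact ⟨by omega, le_of_mul_le_mul_left hx (by linarith)⟩)
    refine le_trans ?_ hf
    rw [mul_comm]
    apply mul_le_mul_of_nonneg_left _ (by positivity)
    refine (hpow _ le_rfl).trans ?_
    apply Real.exp_le_exp.2
    have e : (t*ε)^2/(t:ℝ) = t*ε^2 := by field_simp
    rw [e]
    have : 0 < t * ε^2 := by positivity
    nlinarith [Real.log_two_gt_d9]
  · apply hbig
    have h3 : (t:ℝ) ≤ 3 * ((t/2:ℕ):ℝ) := by exact_mod_cast (by omega : t ≤ 3*(t/2))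
    nlinarith
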